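/- Let τ ∈ ℂ with Im τ > 0, write q = exp(iπτ), and let x, y ∈ ℂ. Then A(x,y|3τ)³ − C(x,y|3τ)³ = ∏_{k=1}^∞ (1−q^{6k})⁶·(1−q^{18k−6}e^{6ix})·(1−q^{18k−12}e^{−6ix})·(1−q^{18k−6}e^{6iy})·(1−q^{18k−12}e^{−6iy})·(1−q^{18k−6}e^{−6i(x+y)})·(1−q^{18k−12}e^{6i(x+y)}). -/

import Mathlib

open Complex

/-- The theta series A(x,y|τ). -/
noncomputable def Afun (x y τ : ℂ) : ℂ :=
  ∑' k : ℤ, ∑' l : ℤ,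
    Complex.exp (2 * Complex.I * Real.pi * τ * ((k : ℂ) ^ 2 + (k : ℂ) * (l : ℂ) + (l : ℂ) ^ 2)) *
    Complex.exp (2 * Complex.I * x * (2 * (l : ℂ) + (k : ℂ))) *
    Complex.exp (2 * Complex.I * y * (2 * (k : ℂ) + (l : ℂ)))

/-- The theta series C(x,y|τ). -/
noncomputable def Cfun (x y τ : ℂ) : ℂ :=
  Complex.exp (2 * Complex.I * (x + y)) * ∑' k : ℤ, ∑' l : ℤ,
    Complex.exp (2 * Complex.I * Real.pi * τ *
      ((k : ℂ) ^ 2 + (k : ℂ) * (l : ℂ) + (l : ℂ) ^ 2 + (k : ℂ) + (l : ℂ) + 1 / 3)) *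
    Complex.exp (2 * Complex.I * x * (2 * (l : ℂ) + (k : ℂ))) *
    Complex.exp (2 * Complex.I * y * (2 * (k : ℂ) + (l : ℂ)))

/-- general term of the Jacobi triple product series -/
noncomputable def jt (L Z : ℂ) (n : ℤ) : ℂ :=
  (-1) ^ n * Complex.exp (L * ((n : ℂ) * (n - 1) / 2) + n * Z)

lemma jt_succ (L Z : ℂ) (n : ℤ) :
    jt L Z (n + 1) = - (jt L Z n * Complex.exp L ^ n * Complex.exp Z) := by
  unfold jt
  rw [zpow_add₀ (by norm_num), ← Complex.exp_int_mul, zpow_one, mul_assoc, mul_assoc, mul_assoc, ← Complex.exp_add, ← Complex.exp_add, neg_one_mul, mul_neg]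
  congr 3
  push_cast
  ring

lemma jt_summable (L Z : ℂ) (hL : L.re < 0) : Summable (jt L Z) := by
  have hpi : (Real.pi : ℂ) ≠ 0 := by exact_mod_cast Real.pi_ne_zero
  have h := (summable_jacobiTheta₂_term_iff
    ((Z - L / 2 + Real.pi * Complex.I) / (2 * Real.pi * Complex.I)) (L / (2 * Real.pi * Complex.I))).2 (by
      have : L / (2 * Real.pi * Complex.I) = ((1 / (2 * Real.pi) : ℝ) : ℂ) * (-(L * Complex.I)) := by
        push_cast
        field_simp
        simp
      rw [this, Complex.im_ofReal_mul]
      have h2 : (-(L * Complex.I)).im = - L.re := by simp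
      rw [h2]
      exact mul_pos (by positivity) (by linarith))
  refine h.congr fun n => ?_
  unfold jt jacobiTheta₂_term
  have : ((-1 : ℂ)) ^ n = Complex.exp (n * (Real.pi * Complex.I)) := by
    rw [Complex.exp_int_mul, Complex.exp_pi_mul_I]
  rw [this, ← Complex.exp_add]
  congr 1
  field_simp
  ring

noncomputable def Pq (q : ℂ) (n : ℕ) : ℂ := ∏ i ∈ Finset.range n, (1 - q ^ (i + 1))

noncomputable def Rq (q : ℂ) (m : ℤ) : ℂ := if 0 ≤ m then (Pq q m.toNat)⁻¹ else 0

lemma one_sub_pow_ne {q : ℂ} (hq : ‖q‖ < 1) (i : ℕ) : 1 - q ^ (i + 1) ≠ 0 := by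
  intro h
  have h1 : q ^ (i + 1) = 1 := (sub_eq_zero.1 h).symm
  have h2 : ‖q‖ ^ (i + 1) < 1 := pow_lt_one₀ (norm_nonneg _) hq (by omega)
  rw [← norm_pow, h1, norm_one] at h2
  exact lt_irrefl _ h2

lemma Pq_ne {q : ℂ} (hq : ‖q‖ < 1) (n : ℕ) : Pq q n ≠ 0 :=
  Finset.prod_ne_zero_iff.2 fun i _ => one_sub_pow_ne hq i

lemma Rq_rec {q : ℂ} (hq : ‖q‖ < 1) (m : ℤ) : Rq q m = (1 - q ^ (m + 1)) * Rq q (m + 1) := by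
  unfold Rq
  rcases lt_trichotomy m (-1) with h | h | h
  · rw [if_neg (by omega), if_neg (by omega), mul_zero]
  · subst h; simp
  · obtain ⟨n, rfl⟩ := Int.eq_ofNat_of_zero_le (show 0 ≤ m by omega)
    rw [if_pos (by omega), if_pos (by omega)]
    have : ((n : ℤ) + 1).toNat = n + 1 := by omega
    have h2 : q ^ ((n : ℤ) + 1) = q ^ (n + 1) := by exact_mod_cast zpow_natCast q (n + 1)
    rw [this, h2, Int.toNat_natCast]
    unfold Pq
    rw [Finset.prod_range_succ]
    have := one_sub_pow_ne hq n
    have := Pq_ne hq n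
    unfold Pq at this
    field_simp

lemma summable_geo {q : ℂ} (hq : ‖q‖ < 1) (a b : ℕ) (ha : 0 < a) (c : ℂ) :
    Summable fun k : ℕ => ‖-(q ^ (a * k + b) * c)‖ := by
  have h : Summable fun k : ℕ => (‖q‖ ^ a) ^ k :=
    summable_geometric_of_lt_one (by positivity) (pow_lt_one₀ (norm_nonneg _) hq ha.ne')
  refine (h.mul_right (‖q‖ ^ b * ‖c‖)).congr fun k => ?_
  rw [norm_neg, norm_mul, norm_pow, pow_add, pow_mul]
  ring

lemma mult_geo {q : ℂ} (hq : ‖q‖ < 1) (a b : ℕ) (ha : 0 < a) (c : ℂ) :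
    Multipliable fun k : ℕ => 1 - q ^ (a * k + b) * c := by
  simpa [sub_eq_add_neg] using multipliable_one_add_of_summable (summable_geo hq a b ha c)

lemma mult_euler {q : ℂ} (hq : ‖q‖ < 1) : Multipliable fun k : ℕ => 1 - q ^ (k + 1) := by
  simpa using mult_geo hq 1 1 one_pos 1

noncomputable def Einf (q : ℂ) : ℂ := ∏' k : ℕ, (1 - q ^ (k + 1))

lemma Einf_ne {q : ℂ} (hq : ‖q‖ < 1) : Einf q ≠ 0 := by
  unfold Einf
  have := tprod_one_add_ne_zero_of_summable (f := fun k : ℕ => -(q ^ (1 * k + 1) * 1))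
    (by intro i; simpa [sub_eq_add_neg] using one_sub_pow_ne hq i) (summable_geo hq 1 1 one_pos 1)
  simpa [sub_eq_add_neg] using this

open Filter Topology in
lemma Pq_tendsto {q : ℂ} (hq : ‖q‖ < 1) : Tendsto (Pq q) atTop (𝓝 (Einf q)) :=
  (mult_euler hq).tendsto_prod_tprod_nat

open Filter Topology in
lemma Pq_bdd {q : ℂ} (hq : ‖q‖ < 1) : ∃ B : ℝ, 0 ≤ B ∧ ∀ n, ‖Pq q n‖ ≤ B := by
  obtain ⟨B, hB⟩ := (Metric.isBounded_range_of_tendsto _ (Pq_tendsto hq)).exists_norm_le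
  exact ⟨B, (norm_nonneg _).trans (hB _ ⟨0, rfl⟩), fun n => hB _ ⟨n, rfl⟩⟩

open Filter Topology in
lemma Rq_bdd {q : ℂ} (hq : ‖q‖ < 1) : ∃ B : ℝ, 0 ≤ B ∧ ∀ n, ‖Rq q n‖ ≤ B := by
  obtain ⟨B, hB⟩ := (Metric.isBounded_range_of_tendsto _
    ((Pq_tendsto hq).inv₀ (Einf_ne hq))).exists_norm_le
  have h0 : 0 ≤ B := (norm_nonneg _).trans (hB _ ⟨0, rfl⟩)
  refine ⟨B, h0, fun n => ?_⟩
  unfold Rq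
  split_ifs
  · exact hB _ ⟨_, rfl⟩
  · simpa using h0

open Filter Topology in
lemma Rq_tendsto {q : ℂ} (hq : ‖q‖ < 1) : Tendsto (Rq q) atTop (𝓝 (Einf q)⁻¹) := by
  have h1 : Tendsto (fun m : ℤ => (Pq q m.toNat)⁻¹) atTop (𝓝 (Einf q)⁻¹) := by
    refine ((Pq_tendsto hq).inv₀ (Einf_ne hq)).comp ?_
    refine tendsto_atTop.2 fun b => ?_
    filter_upwards [eventually_ge_atTop (b : ℤ)] with m hm
    omega
  refine h1.congr' ?_
  filter_upwards [eventually_ge_atTop (0 : ℤ)] with m hm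
  simp [Rq, hm]

lemma jtp_finite (L Z : ℂ) (hL : ‖Complex.exp L‖ < 1) (n : ℕ) :
    HasSum (fun j : ℤ => jt L Z j *
      (Pq (Complex.exp L) (2 * n) * Rq (Complex.exp L) (n + j) * Rq (Complex.exp L) (n - j)))
      (∏ i ∈ Finset.range n, ((1 - Complex.exp L ^ i * Complex.exp Z) *
        (1 - Complex.exp L ^ (i + 1) * Complex.exp (-Z)))) := by
  set q := Complex.exp L with hqd
  have hq0 : q ≠ 0 := Complex.exp_ne_zero _
  induction n with
  | zero =>
    have : (1 : ℂ) = jt L Z 0 * (Pq q (2 * 0) * Rq q ((0 : ℕ) + 0) * Rq q ((0 : ℕ) - 0)) := by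
      simp [jt, Pq, Rq]
    rw [Finset.prod_range_zero, this]
    refine hasSum_single 0 fun j hj => ?_
    rcases lt_or_gt_of_ne hj with h | h
    · simp [Rq, show ¬ (0 ≤ j) by omega]
    · simp [Rq, show ¬ (j ≤ 0) by omega]
  | succ n ih =>
    rw [Finset.prod_range_succ]
    set S := ∏ i ∈ Finset.range n, ((1 - q ^ i * Complex.exp Z) *
        (1 - q ^ (i + 1) * Complex.exp (-Z)))
    have hm := (Equiv.addRight (-1 : ℤ)).hasSum_iff.2 ih
    have hp := (Equiv.addRight (1 : ℤ)).hasSum_iff.2 ih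
    have key := ((ih.mul_left (1 + q ^ (2 * n + 1))).sub (hm.mul_left (q ^ n * Complex.exp Z))).sub
      (hp.mul_left (q ^ (n + 1) * Complex.exp (-Z)))
    have hZ : Complex.exp Z * Complex.exp (-Z) = 1 := by rw [← Complex.exp_add]; simp
    refine (congrArg₂ HasSum (funext fun j => ?_) ?_).mpr key
    · simp only [Function.comp_apply, Equiv.coe_addRight]
      have e1 : jt L Z (j + 1) = - (jt L Z j * q ^ j * Complex.exp Z) := jt_succ L Z j
      have e2 : jt L Z j = - (jt L Z (j + -1) * q ^ (j + -1) * Complex.exp Z) := by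
        have := jt_succ L Z (j + -1)
        rwa [show j + -1 + 1 = j by ring] at this
      have e2' : Complex.exp Z * jt L Z (j + -1) = - (jt L Z j * q ^ (1 - j)) := by
        rw [e2]
        have : q ^ (j + -1) * q ^ (1 - j) = 1 := by rw [← zpow_add₀ hq0, show j + -1 + (1 - j) = 0 by ring, zpow_zero]
        linear_combination (- jt L Z (j + -1) * Complex.exp Z) * this
      have e1' : Complex.exp (-Z) * jt L Z (j + 1) = - (jt L Z j * q ^ j) := by
        rw [e1]
        linear_combination (- jt L Z j * q ^ j) * hZ
      have r1 := Rq_rec hL ((n : ℤ) + j)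
      have r2 := Rq_rec hL ((n : ℤ) - j)
      have r3 := Rq_rec hL ((n : ℤ) + j - 1)
      have r4 := Rq_rec hL ((n : ℤ) - j - 1)
      rw [show (n : ℤ) + j - 1 + 1 = n + j by ring] at r3
      rw [show (n : ℤ) - j - 1 + 1 = n - j by ring] at r4
      rw [show ((n + 1 : ℕ) : ℤ) + j = n + j + 1 by push_cast; ring,
        show ((n + 1 : ℕ) : ℤ) - j = n - j + 1 by push_cast; ring,
        show (n : ℤ) + (j + -1) = n + j - 1 by ring, show (n : ℤ) - (j + -1) = n - j + 1 by ring,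
        show (n : ℤ) + (j + 1) = n + j + 1 by ring, show (n : ℤ) - (j + 1) = n - j - 1 by ring]
      have hP : Pq q (2 * (n + 1)) = Pq q (2 * n) * (1 - q ^ (2 * n + 1)) * (1 - q ^ (2 * n + 2)) := by
        unfold Pq
        rw [show 2 * (n + 1) = 2 * n + 1 + 1 by ring, Finset.prod_range_succ,
          Finset.prod_range_succ]
      rw [hP, r3, r4, r1, r2]
      have z1 : q ^ ((n : ℤ) + j + 1) = q ^ ((n : ℤ) + j) * q := zpow_add_one₀ hq0 _
      have z2 : q ^ ((n : ℤ) - j + 1) = q ^ ((n : ℤ) - j) * q := zpow_add_one₀ hq0 _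
      have z3 : q ^ (2 * n) = q ^ ((n : ℤ) + j) * q ^ ((n : ℤ) - j) := by
        rw [← zpow_add₀ hq0, ← zpow_natCast]; congr 1; push_cast; ring
      have z4 : q ^ n * q ^ (1 - j) = q ^ ((n : ℤ) - j) * q := by
        rw [← zpow_natCast, ← zpow_add₀ hq0, ← z2]; congr 1; ring
      have z5 : q ^ n * q ^ j = q ^ ((n : ℤ) + j) := by
        rw [← zpow_natCast, ← zpow_add₀ hq0]
      rw [pow_succ q (2 * n), pow_succ q n, show q ^ (2 * n + 2) = q ^ (2 * n) * q * q by ring,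
        z1, z2, z3]
      generalize Rq q ((n : ℤ) + j + 1) = a at *
      generalize Rq q ((n : ℤ) - j + 1) = b at *
      generalize q ^ ((n : ℤ) + j) = α at *
      generalize q ^ ((n : ℤ) - j) = β at *
      generalize Pq q (2 * n) = p at *
      generalize jt L Z (j + 1) = tp at *
      generalize jt L Z (j + -1) = tm at *
      generalize jt L Z j = t at *
      generalize q ^ (1 - j) = w1 at *
      generalize q ^ j = w2 at *
      generalize q ^ n = w3 at *
      linear_combination (w3 * (p * ((1 - α) * ((1 - α * q) * a)) * b)) * e2' +
        (w3 * q * (p * a * ((1 - β) * ((1 - β * q) * b)))) * e1' -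
        (t * (p * ((1 - α) * ((1 - α * q) * a)) * b)) * z4 -
        (t * q * (p * a * ((1 - β) * ((1 - β * q) * b)))) * z5
    · rw [show 2 * n + 1 = n + n + 1 by ring, pow_succ q n, pow_succ q (n + n), pow_add]
      linear_combination (S * q ^ n * q ^ n * q) * hZ

open Filter Topology in
/-- Jacobi triple product -/
lemma jtp (L Z : ℂ) (hL : L.re < 0) :
    ∑' j, jt L Z j = Einf (Complex.exp L) *
      ((∏' k : ℕ, (1 - Complex.exp L ^ k * Complex.exp Z)) *
      ∏' k : ℕ, (1 - Complex.exp L ^ (k + 1) * Complex.exp (-Z))) := by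
  have hq : ‖Complex.exp L‖ < 1 := by rw [Complex.norm_exp]; exact Real.exp_lt_one_iff.2 hL
  set q := Complex.exp L with hqd
  obtain ⟨B, hB0, hB⟩ := Pq_bdd hq
  obtain ⟨C, hC0, hC⟩ := Rq_bdd hq
  have m1 : Multipliable fun k : ℕ => (1 - q ^ k * Complex.exp Z) := by
    simpa using mult_geo hq 1 0 one_pos (Complex.exp Z)
  have m2 : Multipliable fun k : ℕ => (1 - q ^ (k + 1) * Complex.exp (-Z)) := by
    simpa using mult_geo hq 1 1 one_pos (Complex.exp (-Z))
  have t1 := (m1.mul m2).tendsto_prod_tprod_nat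
  rw [m1.tprod_mul m2] at t1
  have t2 : Tendsto (fun n : ℕ => ∑' j : ℤ, jt L Z j *
      (Pq q (2 * n) * Rq q (n + j) * Rq q (n - j))) atTop
      (𝓝 (∑' j : ℤ, jt L Z j * (Einf q * (Einf q)⁻¹ * (Einf q)⁻¹))) := by
    refine tendsto_tsum_of_dominated_convergence (bound := fun j => ‖jt L Z j‖ * (B * C * C))
      ((jt_summable L Z hL).norm.mul_right _) ?_ ?_
    · intro j
      refine tendsto_const_nhds.mul (((?_ : Tendsto _ _ _).mul ?_).mul ?_)
      · refine (Pq_tendsto hq).comp (tendsto_atTop_mono (fun n => ?_) tendsto_id)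
        simp only [id]; omega
      · refine (Rq_tendsto hq).comp ?_
        exact tendsto_atTop_add_const_right _ _ tendsto_natCast_atTop_atTop
      · refine (Rq_tendsto hq).comp ?_
        exact tendsto_atTop_add_const_right _ _ tendsto_natCast_atTop_atTop
    · refine Eventually.of_forall fun n j => ?_
      rw [norm_mul, norm_mul, norm_mul]
      gcongr
      · exact hB _
      · exact hC _
      · exact hC _
  have t3 := t2.congr fun n => (jtp_finite L Z hq n).tsum_eq
  have := tendsto_nhds_unique t3 t1
  rw [tsum_mul_right, mul_inv_cancel₀ (Einf_ne hq), one_mul] at this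
  rw [← this]
  field_simp [Einf_ne hq]

lemma Einf_three {q : ℂ} (hq : ‖q‖ < 1) :
    Einf q = (∏' k : ℕ, (1 - q ^ (3 * k + 1))) * (∏' k : ℕ, (1 - q ^ (3 * k + 2))) *
      (∏' k : ℕ, (1 - q ^ (3 * k + 3))) := by
  have h1 := (mult_euler hq).hasProd
  have h2 := (Nat.divModEquiv 3).symm.hasProd_iff.2 h1
  have h3 := h2.prod_fiberwise (fun b => hasProd_fintype _)
  have m (b : ℕ) : Multipliable fun k : ℕ => 1 - q ^ (3 * k + b) := by
    simpa using mult_geo hq 3 b (by norm_num) 1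
  rw [Einf, ← h3.tprod_eq, ← (m 1).tprod_mul (m 2), ← ((m 1).mul (m 2)).tprod_mul (m 3)]
  refine tprod_congr fun k => ?_
  simp [Fin.prod_univ_three, mul_comm k 3]

lemma pent (L : ℂ) (hL : L.re < 0) : ∑' t, jt (3 * L) (2 * L) t = Einf (Complex.exp L) := by
  have hq : ‖Complex.exp L‖ < 1 := by rw [Complex.norm_exp]; exact Real.exp_lt_one_iff.2 hL
  rw [jtp (3 * L) (2 * L) (by simp; linarith), Einf_three hq, Einf]
  have h3 : Complex.exp (3 * L) = Complex.exp L ^ 3 := by rw [← Complex.exp_nat_mul]; norm_num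
  have h2 : Complex.exp (2 * L) = Complex.exp L ^ 2 := by rw [← Complex.exp_nat_mul]; norm_num
  have h0 := Complex.exp_ne_zero L
  rw [Complex.exp_neg, h3, h2]
  set q := Complex.exp L
  have a1 : ∀ k : ℕ, 1 - (q ^ 3) ^ (k + 1) = 1 - q ^ (3 * k + 3) := by intro k; ring
  have a2 : ∀ k : ℕ, 1 - (q ^ 3) ^ k * q ^ 2 = 1 - q ^ (3 * k + 2) := by intro k; ring
  have a3 : ∀ k : ℕ, 1 - (q ^ 3) ^ (k + 1) * (q ^ 2)⁻¹ = 1 - q ^ (3 * k + 1) := by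
    intro k; rw [← pow_mul, show 3 * (k + 1) = 3 * k + 1 + 2 by ring, pow_add q _ 2]; field_simp
  rw [tprod_congr a1, tprod_congr a2, tprod_congr a3]
  ring

/-- the shear `(s,(k,l)) ↦ (l+⌊(s+1)/3⌋, k+⌊(s+1)/3⌋, ⋯)` with total sum `s` -/
def shear : ℤ × (ℤ × ℤ) ≃ ℤ × (ℤ × ℤ) where
  toFun p := (p.2.2 + (p.1 + 1) / 3, (p.2.1 + (p.1 + 1) / 3,
    p.1 - 2 * ((p.1 + 1) / 3) - p.2.1 - p.2.2))
  invFun n := (n.1 + n.2.1 + n.2.2, (n.2.1 - (n.1 + n.2.1 + n.2.2 + 1) / 3,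
    n.1 - (n.1 + n.2.1 + n.2.2 + 1) / 3))
  left_inv p := by
    obtain ⟨s, k, l⟩ := p
    have : l + (s + 1) / 3 + (k + (s + 1) / 3) + (s - 2 * ((s + 1) / 3) - k - l) = s := by ring
    simp only [this]
    ext <;> simp
  right_inv n := by
    obtain ⟨a, b, c⟩ := n
    ext <;> simp
    ring

/-- the full reindexing -/
def reidx : Fin 3 × (ℤ × (ℤ × ℤ)) ≃ ℤ × (ℤ × ℤ) :=
  (Equiv.prodAssoc _ _ _).symm.trans
    (((Equiv.prodCongr ((Equiv.prodComm _ _).trans (Int.divModEquiv 3).symm)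
      (Equiv.refl _))).trans shear)

lemma reidx_0 (t k l : ℤ) : reidx (0, (t, (k, l))) = (l + t, (k + t, t - k - l)) := by
  have h : (t * 3 + 1) / 3 = t := by omega
  simp [reidx, shear, h]
  ring

lemma reidx_1 (t k l : ℤ) : reidx (1, (t, (k, l))) = (l + t, (k + t, t + 1 - k - l)) := by
  have h : (t * 3 + 1 + 1) / 3 = t := by omega
  simp [reidx, shear, h]
  ring

lemma reidx_2 (t k l : ℤ) :
    reidx (2, (t, (k, l))) = (l + t + 1, (k + t + 1, t - k - l)) := by
  have h : (t * 3 + 2 + 1) / 3 = t + 1 := by omega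
  simp [reidx, shear, h]
  exact ⟨by ring, by ring, by ring⟩

noncomputable def X1 (L : ℂ) (t : ℤ) : ℂ :=
  (-1) ^ (t + 1) * Complex.exp (L * ((3 * t + 1) * (3 * t + 2) / 6))
noncomputable def X2 (L : ℂ) (t : ℤ) : ℂ :=
  (-1) ^ t * Complex.exp (L * ((3 * t + 2) * (3 * t + 3) / 6))
noncomputable def D0 (L U V : ℂ) (p : ℤ × ℤ) : ℂ :=
  Complex.exp (L * ((p.1 : ℂ) ^ 2 + p.1 * p.2 + p.2 ^ 2) + U * (2 * p.2 + p.1)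
    + V * (2 * p.1 + p.2))
noncomputable def D1 (L U V : ℂ) (p : ℤ × ℤ) : ℂ :=
  Complex.exp (L * ((p.1 : ℂ) ^ 2 + p.1 * p.2 + p.2 ^ 2 - p.1 - p.2 + 1 / 3)
    + U * (2 * p.2 + p.1 - 1) + V * (2 * p.1 + p.2 - 1))
noncomputable def D2 (L U V : ℂ) (p : ℤ × ℤ) : ℂ :=
  Complex.exp (L * ((p.1 : ℂ) ^ 2 + p.1 * p.2 + p.2 ^ 2 + p.1 + p.2 + 1 / 3)
    + U * (2 * p.2 + p.1 + 1) + V * (2 * p.1 + p.2 + 1))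

lemma X1_sum (L : ℂ) : ∑' t, X1 L t = 0 := by
  have h := (Equiv.subLeft (-1 : ℤ)).tsum_eq (X1 L)
  have h2 : ∀ t, X1 L (Equiv.subLeft (-1 : ℤ) t) = - X1 L t := by
    intro t
    simp only [Equiv.subLeft_apply, X1]
    rw [show -1 - t + 1 = -t by ring, zpow_add₀ (by norm_num), zpow_neg, ← inv_zpow]
    push_cast
    rw [show ((-1 : ℂ))⁻¹ = -1 by norm_num, zpow_one, mul_neg_one, neg_mul, neg_neg]
    congr 2
    ring
  rw [tsum_congr h2, tsum_neg] at h
  exact self_eq_neg.1 h.symm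

lemma X2_sum (L : ℂ) (hL : L.re < 0) : ∑' t, X2 L t = - Einf (Complex.exp L) := by
  rw [← pent L hL, ← (Equiv.subLeft (-1 : ℤ)).tsum_eq (X2 L), ← tsum_neg]
  refine tsum_congr fun t => ?_
  simp only [Equiv.subLeft_apply, X2, jt]
  rw [zpow_sub₀ (by norm_num), ← inv_mul_eq_div, ← zpow_neg, zpow_neg, ← inv_zpow]
  push_cast
  rw [show ((-1 : ℂ))⁻¹ = -1 by norm_num, zpow_neg_one, show ((-1 : ℂ))⁻¹ = -1 by norm_num,
    mul_neg_one, neg_mul]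
  congr 3
  ring

lemma neg_one_zpow_3 (a b c s t : ℤ) (h : a + b + c = s) (e : s - t = 2 * (s - t) / 2 ∧ (s - t) % 2 = 0) :
    ((-1 : ℂ)) ^ a * (-1) ^ b * (-1) ^ c = (-1) ^ t := by
  rw [← zpow_add₀ (by norm_num), ← zpow_add₀ (by norm_num), h]
  have : s = t + 2 * ((s - t) / 2) := by omega
  rw [this, zpow_add₀ (by norm_num), zpow_mul]
  simp

lemma triple_term (L U V : ℂ) (a b c s : ℤ) (w : ℂ)
    (h : (a + b + c - s) % 2 = 0)
    (hw : L * ((a : ℂ) * (a - 1) / 2) + a * (U + 2 * L / 3) +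
      (L * ((b : ℂ) * (b - 1) / 2) + b * (V + 2 * L / 3)) +
      (L * ((c : ℂ) * (c - 1) / 2) + c * (-(U + V) + 2 * L / 3)) = w) :
    jt L (U + 2 * L / 3) a * (jt L (V + 2 * L / 3) b * jt L (-(U + V) + 2 * L / 3) c)
      = (-1) ^ s * Complex.exp w := by
  unfold jt
  rw [← hw, ← neg_one_zpow_3 a b c _ s rfl (by omega)]
  generalize L * ((a : ℂ) * (a - 1) / 2) + a * (U + 2 * L / 3) = A
  generalize L * ((b : ℂ) * (b - 1) / 2) + b * (V + 2 * L / 3) = B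
  generalize L * ((c : ℂ) * (c - 1) / 2) + c * (-(U + V) + 2 * L / 3) = C
  rw [Complex.exp_add, Complex.exp_add]
  ring

lemma three_sum (L U V : ℂ) (hL : L.re < 0) :
    (Summable (D0 L U V) ∧ Summable (D2 L U V)) ∧
    (∑' n, jt L (U + 2 * L / 3) n) * ((∑' n, jt L (V + 2 * L / 3) n) *
      ∑' n, jt L (-(U + V) + 2 * L / 3) n) =
    Einf (Complex.exp L) * (∑' p, D0 L U V p - ∑' p, D2 L U V p) := by
  have s1 := (jt_summable L (U + 2 * L / 3) hL).norm
  have s2 := (jt_summable L (V + 2 * L / 3) hL).norm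
  have s3 := (jt_summable L (-(U + V) + 2 * L / 3) hL).norm
  have s23 := summable_mul_of_summable_norm s2 s3
  have s123 := summable_mul_of_summable_norm s1 s23.norm
  have key := reidx.summable_iff.2 s123
  have i0 : ∀ t k l : ℤ, _ := fun t k l =>
    triple_term L U V (l + t) (k + t) (t - k - l) t
      ((3 * L * ((t : ℂ) * (t - 1) / 2) + t * (2 * L)) +
        (L * ((k : ℂ) ^ 2 + k * l + l ^ 2) + U * (2 * l + k) + V * (2 * k + l)))
      (by omega) (by push_cast; ring)
  have i1 : ∀ t k l : ℤ, _ := fun t k l =>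
    triple_term L U V (l + t) (k + t) (t + 1 - k - l) (t + 1)
      (L * ((3 * t + 1) * (3 * t + 2) / 6) +
        (L * ((k : ℂ) ^ 2 + k * l + l ^ 2 - k - l + 1 / 3)
    + U * (2 * l + k - 1) + V * (2 * k + l - 1)))
      (by omega) (by push_cast; ring)
  have i2 : ∀ t k l : ℤ, _ := fun t k l =>
    triple_term L U V (l + t + 1) (k + t + 1) (t - k - l) t
      (L * ((3 * t + 2) * (3 * t + 3) / 6) +
        (L * ((k : ℂ) ^ 2 + k * l + l ^ 2 + k + l + 1 / 3)
    + U * (2 * l + k + 1) + V * (2 * k + l + 1)))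
      (by omega) (by push_cast; ring)
  set F : ℤ × (ℤ × ℤ) → ℂ := fun x => jt L (U + 2 * L / 3) x.1 *
    (jt L (V + 2 * L / 3) x.2.1 * jt L (-(U + V) + 2 * L / 3) x.2.2) with hF
  have f0 : (fun p : ℤ × (ℤ × ℤ) => (F ∘ reidx) (0, p)) =
      fun p => jt (3 * L) (2 * L) p.1 * D0 L U V p.2 := by
    funext ⟨t, k, l⟩
    simp only [Function.comp_apply, reidx_0, hF, i0]
    rw [jt, D0, Complex.exp_add, ← mul_assoc]
  have f1 : (fun p : ℤ × (ℤ × ℤ) => (F ∘ reidx) (1, p)) =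
      fun p => X1 L p.1 * D1 L U V p.2 := by
    funext ⟨t, k, l⟩
    simp only [Function.comp_apply, reidx_1, hF, i1, X1, D1]
    rw [Complex.exp_add, mul_assoc]
  have f2 : (fun p : ℤ × (ℤ × ℤ) => (F ∘ reidx) (2, p)) =
      fun p => X2 L p.1 * D2 L U V p.2 := by
    funext ⟨t, k, l⟩
    simp only [Function.comp_apply, reidx_2, hF, i2, X2, D2]
    rw [Complex.exp_add, mul_assoc]
  have g0 := key.prod_factor 0
  have g1 := key.prod_factor 1
  have g2 := key.prod_factor 2
  rw [f0] at g0
  rw [f1] at g1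
  rw [f2] at g2
  have t0 : ∑' p : ℤ × (ℤ × ℤ), jt (3 * L) (2 * L) p.1 * D0 L U V p.2 =
      (∑' t, jt (3 * L) (2 * L) t) * ∑' p, D0 L U V p := by
    rw [g0.tsum_prod]
    simp only [tsum_mul_left, tsum_mul_right]
  have t1 : ∑' p : ℤ × (ℤ × ℤ), X1 L p.1 * D1 L U V p.2 =
      (∑' t, X1 L t) * ∑' p, D1 L U V p := by
    rw [g1.tsum_prod]
    simp only [tsum_mul_left, tsum_mul_right]
  have t2 : ∑' p : ℤ × (ℤ × ℤ), X2 L p.1 * D2 L U V p.2 =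
      (∑' t, X2 L t) * ∑' p, D2 L U V p := by
    rw [g2.tsum_prod]
    simp only [tsum_mul_left, tsum_mul_right]
  refine ⟨⟨?_, ?_⟩, ?_⟩
  · have := g0.prod_factor 0
    simpa [jt] using this
  · have := g2.prod_factor 0
    refine (summable_mul_left_iff (a := X2 L 0) ?_).1 this
    simp [X2]
  · rw [tsum_mul_tsum_of_summable_norm s2 s3, tsum_mul_tsum_of_summable_norm s1 s23.norm]
    change ∑' x, F x = _
    rw [← reidx.tsum_eq F]
    change ∑' x, (F ∘ reidx) x = _
    rw [key.tsum_prod, tsum_fintype, Fin.sum_univ_three, f0, f1, f2, t0, t1, t2, X1_sum, X2_sum L hL,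
      pent L hL]
    ring

noncomputable def Gq (q z : ℂ) : ℂ :=
  (∏' k : ℕ, (1 - q ^ (6 * k + 4) * z)) * ∏' k : ℕ, (1 - q ^ (6 * k + 2) * z⁻¹)

lemma Gq_cube {q : ℂ} (hq : ‖q‖ < 1) (z ω : ℂ) (hω : ω ^ 2 + ω + 1 = 0) :
    Gq q z * Gq q (ω * z) * Gq q (ω * (ω * z)) =
      (∏' k : ℕ, (1 - q ^ (18 * k + 12) * z ^ 3)) *
        ∏' k : ℕ, (1 - q ^ (18 * k + 6) * (z⁻¹) ^ 3) := by
  have m (b : ℕ) (c : ℂ) := mult_geo hq 6 b (by norm_num) c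
  have h3 : ω ^ 3 = 1 := by linear_combination (ω - 1) * hω
  have h0 : ω ≠ 0 := by rintro rfl; simp at h3
  have hinv : ω⁻¹ = ω ^ 2 := by field_simp; exact h3.symm
  have e (b : ℕ) (c : ℂ) : (∏' k : ℕ, (1 - q ^ (6 * k + b) * c)) *
      (∏' k : ℕ, (1 - q ^ (6 * k + b) * (ω * c))) *
      (∏' k : ℕ, (1 - q ^ (6 * k + b) * (ω ^ 2 * c))) =
      ∏' k : ℕ, (1 - q ^ (18 * k + 3 * b) * c ^ 3) := by
    rw [← (m b c).tprod_mul (m b _), ← ((m b c).mul (m b _)).tprod_mul (m b _)]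
    refine tprod_congr fun k => ?_
    have : q ^ (18 * k + 3 * b) = (q ^ (6 * k + b)) ^ 3 := by ring
    rw [this]
    set a := q ^ (6 * k + b)
    linear_combination (-a * c + a ^ 2 * c ^ 2 * ω) * hω - a ^ 3 * c ^ 3 * h3
  have e1 := e 4 z
  have e2 := e 2 z⁻¹
  have w1 : (ω * z)⁻¹ = ω ^ 2 * z⁻¹ := by rw [mul_inv, hinv]
  have w2 : (ω * (ω * z))⁻¹ = ω * z⁻¹ := by
    rw [mul_inv, mul_inv, hinv]; linear_combination (ω * z⁻¹) * h3
  unfold Gq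
  rw [w1, w2, ← mul_assoc ω ω z, ← sq]
  norm_num at e1 e2
  norm_num
  rw [← e1, ← e2]
  ring

lemma A_sub_C (τ q : ℂ) (hτ : 0 < τ.im) (hq : q = Complex.exp (Real.pi * Complex.I * τ))
    (x y : ℂ) : Afun x y (3 * τ) - Cfun x y (3 * τ) =
      Einf (q ^ 6) ^ 2 * (Gq q (Complex.exp (2 * Complex.I * x)) *
        Gq q (Complex.exp (2 * Complex.I * y)) *
        Gq q (Complex.exp (-(2 * Complex.I * x + 2 * Complex.I * y)))) := by
  set L : ℂ := 6 * Real.pi * Complex.I * τ with hLd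
  have hL : L.re < 0 := by
    have : L = ((6 * Real.pi : ℝ) : ℂ) * (Complex.I * τ) := by rw [hLd]; push_cast; ring
    rw [this, Complex.re_ofReal_mul]
    simp only [Complex.I_mul_re]
    have := Real.pi_pos
    nlinarith
  have hQ : Complex.exp L = q ^ 6 := by
    rw [hq, ← Complex.exp_nat_mul]; congr 1; rw [hLd]; push_cast; ring
  have h4 : Complex.exp (2 * L / 3) = q ^ 4 := by
    rw [hq, ← Complex.exp_nat_mul]; congr 1; rw [hLd]; push_cast; ring
  have hq0 : q ≠ 0 := by rw [hq]; exact Complex.exp_ne_zero _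
  have hJ (U : ℂ) : ∑' n, jt L (U + 2 * L / 3) n = Einf (q ^ 6) * Gq q (Complex.exp U) := by
    rw [jtp _ _ hL, hQ, Gq]
    congr 2
    · refine tprod_congr fun k => ?_
      rw [Complex.exp_add, h4]; ring
    · refine tprod_congr fun k => ?_
      rw [Complex.exp_neg, Complex.exp_add, h4, mul_inv, ← pow_mul,
        show 6 * (k + 1) = 6 * k + 2 + 4 by ring, pow_add q _ 4]
      field_simp
  have hE : Einf (q ^ 6) ≠ 0 := by
    rw [← hQ]
    exact Einf_ne (by rw [Complex.norm_exp]; exact Real.exp_lt_one_iff.2 hL)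
  obtain ⟨⟨s0, s2⟩, h⟩ := three_sum L (2 * Complex.I * x) (2 * Complex.I * y) hL
  have hA : Afun x y (3 * τ) = ∑' p, D0 L (2 * Complex.I * x) (2 * Complex.I * y) p := by
    rw [s0.tsum_prod, Afun]
    refine tsum_congr fun k => tsum_congr fun l => ?_
    rw [D0, Complex.exp_add, Complex.exp_add]
    congr 3
    rw [hLd]; ring
  have hC : Cfun x y (3 * τ) = ∑' p, D2 L (2 * Complex.I * x) (2 * Complex.I * y) p := by
    rw [s2.tsum_prod, Cfun, ← tsum_mul_left]
    refine tsum_congr fun k => ?_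
    rw [← tsum_mul_left]
    refine tsum_congr fun l => ?_
    rw [D2, ← Complex.exp_add, ← Complex.exp_add, ← Complex.exp_add]
    congr 1
    rw [hLd]; ring
  rw [hJ, hJ, hJ, hQ, ← hA, ← hC] at h
  refine mul_left_cancel₀ hE ?_
  rw [← h]
  ring

lemma exp_int_two_pi (n : ℤ) : Complex.exp (n * (2 * Real.pi * Complex.I)) = 1 :=
  Complex.exp_int_mul_two_pi_mul_I n

lemma A_shift (x y σ : ℂ) : Afun (x + Real.pi / 3) (y + Real.pi / 3) σ = Afun x y σ := by
  unfold Afun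
  refine tsum_congr fun k => tsum_congr fun l => ?_
  rw [← Complex.exp_add, ← Complex.exp_add, ← Complex.exp_add, ← Complex.exp_add,
    ← mul_one (Complex.exp (_ + 2 * Complex.I * y * _)), ← exp_int_two_pi (k + l),
    ← Complex.exp_add]
  congr 1
  push_cast
  ring

lemma C_shift (x y σ : ℂ) : Cfun (x + Real.pi / 3) (y + Real.pi / 3) σ =
    Complex.exp (2 * Real.pi * Complex.I / 3) ^ 2 * Cfun x y σ := by
  unfold Cfun
  rw [← mul_assoc, ← Complex.exp_nat_mul, ← Complex.exp_add]
  congr 1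
  · congr 1; push_cast; ring
  refine tsum_congr fun k => tsum_congr fun l => ?_
  rw [← Complex.exp_add, ← Complex.exp_add, ← Complex.exp_add, ← Complex.exp_add,
    ← mul_one (Complex.exp (_ + 2 * Complex.I * y * _)), ← exp_int_two_pi (k + l),
    ← Complex.exp_add]
  congr 1
  push_cast
  ring

lemma final_algebra (E a1 a2 a3 b1 b2 b3 c1 c2 c3 p1 p2 p3 p4 p5 p6 : ℂ)
    (h1 : a1 * a2 * a3 = p1 * p2) (h2 : b1 * b2 * b3 = p3 * p4) (h3 : c1 * c2 * c3 = p5 * p6) :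
    E ^ 2 * (a1 * b1 * c1) * (E ^ 2 * (a2 * b2 * c2)) * (E ^ 2 * (a3 * b3 * c3)) =
      E ^ 6 * p1 * p2 * p3 * p4 * p5 * p6 := by
  calc _ = E ^ 6 * (a1 * a2 * a3) * (b1 * b2 * b3) * (c1 * c2 * c3) := by ring
    _ = _ := by rw [h1, h2, h3]; ring

/-- Product representation of `A(x,y|3τ)³ − C(x,y|3τ)³`. -/
theorem A_cube_minus_C_cube_product (τ q : ℂ) (hτ : 0 < τ.im)
    (hq : q = Complex.exp (Real.pi * Complex.I * τ)) (x y : ℂ) :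
    Afun x y (3 * τ) ^ 3 - Cfun x y (3 * τ) ^ 3
      = ∏' k : ℕ,
          (1 - q ^ (6 * k + 6)) ^ 6 *
          (1 - q ^ (18 * k + 12) * Complex.exp (6 * Complex.I * x)) *
          (1 - q ^ (18 * k + 6) * Complex.exp (-6 * Complex.I * x)) *
          (1 - q ^ (18 * k + 12) * Complex.exp (6 * Complex.I * y)) *
          (1 - q ^ (18 * k + 6) * Complex.exp (-6 * Complex.I * y)) *
          (1 - q ^ (18 * k + 12) * Complex.exp (-6 * Complex.I * (x + y))) *
          (1 - q ^ (18 * k + 6) * Complex.exp (6 * Complex.I * (x + y))) := by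
  have hq1 : ‖q‖ < 1 := by
    rw [hq, Complex.norm_exp]
    refine Real.exp_lt_one_iff.2 ?_
    rw [mul_assoc, Complex.re_ofReal_mul, Complex.I_mul_re]
    have := Real.pi_pos
    nlinarith
  set ω := Complex.exp (2 * Real.pi * Complex.I / 3) with hωd
  have h3 : ω ^ 3 = 1 := by
    rw [hωd, ← Complex.exp_nat_mul, ← Complex.exp_two_pi_mul_I]; congr 1; push_cast; ring
  have hne : ω ≠ 1 := by
    have := (Complex.isPrimitiveRoot_exp 3 (by norm_num)).ne_one (by norm_num)
    simpa [hωd] using this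
  have hω : ω ^ 2 + ω + 1 = 0 := by
    refine mul_left_cancel₀ (sub_ne_zero.2 hne) ?_
    linear_combination h3
  have b0 := A_sub_C τ q hτ hq x y
  have b1 := A_sub_C τ q hτ hq (x + Real.pi / 3) (y + Real.pi / 3)
  have b2 := A_sub_C τ q hτ hq (x + Real.pi / 3 + Real.pi / 3) (y + Real.pi / 3 + Real.pi / 3)
  rw [A_shift, C_shift, A_shift, C_shift] at b2
  rw [A_shift, C_shift] at b1
  have sh (u : ℂ) : Complex.exp (2 * Complex.I * (u + Real.pi / 3)) =
      ω * Complex.exp (2 * Complex.I * u) := by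
    rw [hωd, ← Complex.exp_add]; congr 1; ring
  have sh2 (u v : ℂ) : Complex.exp (-(2 * Complex.I * (u + Real.pi / 3) +
      2 * Complex.I * (v + Real.pi / 3))) =
      ω * Complex.exp (-(2 * Complex.I * u + 2 * Complex.I * v)) := by
    rw [hωd, ← Complex.exp_add, Complex.exp_eq_exp_iff_exists_int]
    exact ⟨-1, by push_cast; ring⟩
  rw [sh2, sh2, sh, sh, sh, sh] at b2
  rw [sh2, sh, sh] at b1
  rw [← hωd] at b1 b2
  set A := Afun x y (3 * τ)
  set C := Cfun x y (3 * τ)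
  have fac : A ^ 3 - C ^ 3 = (A - C) * (A - ω ^ 2 * C) * (A - ω ^ 2 * (ω ^ 2 * C)) := by
    have h4 : ω ^ 4 = ω := by linear_combination ω * h3
    have h6 : ω ^ 6 = 1 := by linear_combination (ω ^ 3 + 1) * h3
    linear_combination (A ^ 2 * C - A * C ^ 2) * hω + (A ^ 2 * C - A * C ^ 2) * h4 +
      (C ^ 3 - A * C ^ 2) * h6
  have c1 := Gq_cube hq1 (Complex.exp (2 * Complex.I * x)) ω hω
  have c2 := Gq_cube hq1 (Complex.exp (2 * Complex.I * y)) ω hω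
  have c3 := Gq_cube hq1 (Complex.exp (-(2 * Complex.I * x + 2 * Complex.I * y))) ω hω
  rw [← Complex.exp_neg, ← Complex.exp_nat_mul, ← Complex.exp_nat_mul] at c1 c2 c3
  rw [show ((3 : ℕ) : ℂ) * (2 * Complex.I * x) = 6 * Complex.I * x by push_cast; ring,
    show ((3 : ℕ) : ℂ) * (-(2 * Complex.I * x)) = -6 * Complex.I * x by push_cast; ring] at c1
  rw [show ((3 : ℕ) : ℂ) * (2 * Complex.I * y) = 6 * Complex.I * y by push_cast; ring,
    show ((3 : ℕ) : ℂ) * (-(2 * Complex.I * y)) = -6 * Complex.I * y by push_cast; ring] at c2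
  rw [show ((3 : ℕ) : ℂ) * (-(2 * Complex.I * x + 2 * Complex.I * y)) =
      -6 * Complex.I * (x + y) by push_cast; ring,
    show ((3 : ℕ) : ℂ) * (-(-(2 * Complex.I * x + 2 * Complex.I * y))) =
      6 * Complex.I * (x + y) by push_cast; ring] at c3
  have mE : Multipliable fun k : ℕ => 1 - q ^ (6 * k + 6) := by
    simpa using mult_geo hq1 6 6 (by norm_num) 1
  have mE6 : Multipliable fun k : ℕ => (1 - q ^ (6 * k + 6)) ^ 6 := mE.pow 6
  have hEE : Einf (q ^ 6) = ∏' k : ℕ, (1 - q ^ (6 * k + 6)) :=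
    tprod_congr fun k => by ring
  have m (b : ℕ) (c : ℂ) := mult_geo hq1 18 b (by norm_num) c
  rw [(((((mE6.mul (m 12 _)).mul (m 6 _)).mul (m 12 _)).mul (m 6 _)).mul (m 12 _)).tprod_mul (m 6 _),
    ((((mE6.mul (m 12 _)).mul (m 6 _)).mul (m 12 _)).mul (m 6 _)).tprod_mul (m 12 _),
    (((mE6.mul (m 12 _)).mul (m 6 _)).mul (m 12 _)).tprod_mul (m 6 _),
    ((mE6.mul (m 12 _)).mul (m 6 _)).tprod_mul (m 12 _),
    (mE6.mul (m 12 _)).tprod_mul (m 6 _),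
    mE6.tprod_mul (m 12 _), mE.tprod_pow 6, ← hEE, fac, b0, b1, b2]
  exact final_algebra _ _ _ _ _ _ _ _ _ _ _ _ _ _ _ _ c1 c2 c3
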